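/- arXiv:2003.06036 — 7 statements merged into one kernel-verified Lean document; each statement's English description precedes it below -/
import Mathlib

section
/- Let f : 3^N → ℝ be a bisubmodular function with f(∅,∅) = 0 and let π ∈ ℝ^n. The inequality π·x ≤ z holds for every point (x,z) in Q_f (the convex hull of the epigraph of f) if and only if π belongs to the bisubmodular polyhedron P_f. -/
open Finset

/-- A function `f` on pairs of disjoint subsets of `{0, …, n-1}` is bisubmodular. -/
def Bisubmodular (n : ℕ) (f : Finset (Fin n) → Finset (Fin n) → ℝ) : Prop :=
  ∀ X₁ X₂ Y₁ Y₂ : Finset (Fin n), Disjoint X₁ X₂ → Disjoint Y₁ Y₂ →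
    f (X₁ ∩ Y₁) (X₂ ∩ Y₂) + f ((X₁ ∪ Y₁) \ (X₂ ∪ Y₂)) ((X₂ ∪ Y₂) \ (X₁ ∪ Y₁)) ≤
      f X₁ X₂ + f Y₁ Y₂

/-- `x` is a ternary (±1/0) vector. -/
def IsTernary (n : ℕ) (x : Fin n → ℝ) : Prop := ∀ i, x i = -1 ∨ x i = 0 ∨ x i = 1

/-- The set `S₁ˣ = {i : x i = 1}`. -/
noncomputable def posSet (n : ℕ) (x : Fin n → ℝ) : Finset (Fin n) :=
  Finset.univ.filter (fun i => x i = 1)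

/-- The set `S₂ˣ = {i : x i = -1}`. -/
noncomputable def negSet (n : ℕ) (x : Fin n → ℝ) : Finset (Fin n) :=
  Finset.univ.filter (fun i => x i = -1)

/-- The bisubmodular polyhedron `P_f`. -/
def bisubPolyhedron (n : ℕ) (f : Finset (Fin n) → Finset (Fin n) → ℝ) : Set (Fin n → ℝ) :=
  {π | ∀ S₁ S₂ : Finset (Fin n), Disjoint S₁ S₂ →
    (∑ i ∈ S₁, π i) - (∑ j ∈ S₂, π j) ≤ f S₁ S₂}

/-- `Q_f`, the convex hull of the epigraph of `f` over ternary vectors. -/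
noncomputable def epigraphQ (n : ℕ) (f : Finset (Fin n) → Finset (Fin n) → ℝ) :
    Set ((Fin n → ℝ) × ℝ) :=
  convexHull ℝ {p : (Fin n → ℝ) × ℝ |
    IsTernary n p.1 ∧ f (posSet n p.1) (negSet n p.1) ≤ p.2}

/-- `S₁ᵏ = {δ_j : j ≤ k (1-based), σ_{δ_j} = 1}` (here `j` ranges over `Fin n`, 0-based). -/
noncomputable def greedyS1 (n : ℕ) (δ : Equiv.Perm (Fin n)) (σ : Fin n → ℝ) (k : ℕ) :
    Finset (Fin n) :=
  (Finset.univ.filter (fun j : Fin n => (j : ℕ) < k ∧ σ (δ j) = 1)).image δ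

/-- `S₂ᵏ = {δ_j : j ≤ k (1-based), σ_{δ_j} = -1}`. -/
noncomputable def greedyS2 (n : ℕ) (δ : Equiv.Perm (Fin n)) (σ : Fin n → ℝ) (k : ℕ) :
    Finset (Fin n) :=
  (Finset.univ.filter (fun j : Fin n => (j : ℕ) < k ∧ σ (δ j) = -1)).image δ

/-- The signed greedy vector `π^{δ,σ}` for `f`:
`π_{δ_k} = σ_{δ_k} · (f(S₁ᵏ,S₂ᵏ) − f(S₁ᵏ⁻¹,S₂ᵏ⁻¹))`. -/
noncomputable def signedGreedy (n : ℕ) (f : Finset (Fin n) → Finset (Fin n) → ℝ)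
    (δ : Equiv.Perm (Fin n)) (σ : Fin n → ℝ) : Fin n → ℝ :=
  fun i => σ i *
    (f (greedyS1 n δ σ ((δ.symm i : ℕ) + 1)) (greedyS2 n δ σ ((δ.symm i : ℕ) + 1)) -
     f (greedyS1 n δ σ (δ.symm i : ℕ)) (greedyS2 n δ σ (δ.symm i : ℕ)))

theorem sum_mul_eq_of_isTernary {n : ℕ} {x : Fin n → ℝ} (hx : IsTernary n x) (π : Fin n → ℝ) :
    ∑ i, π i * x i = ∑ i ∈ posSet n x, π i - ∑ i ∈ negSet n x, π i := by
  simp only [posSet, negSet, Finset.sum_filter, ← Finset.sum_sub_distrib]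
  refine Finset.sum_congr rfl fun i _ => ?_
  rcases hx i with h | h | h <;> norm_num [h]

theorem disjoint_posSet_negSet (n : ℕ) (x : Fin n → ℝ) : Disjoint (posSet n x) (negSet n x) := by
  refine Finset.disjoint_filter.2 fun i _ h h' => ?_
  linarith

/-- Every pair of disjoint sets arises from a ternary vector. -/
theorem exists_isTernary_of_disjoint {n : ℕ} {S₁ S₂ : Finset (Fin n)} (h : Disjoint S₁ S₂) :
    ∃ x : Fin n → ℝ, IsTernary n x ∧ posSet n x = S₁ ∧ negSet n x = S₂ := by
  refine ⟨fun i => if i ∈ S₁ then 1 else if i ∈ S₂ then -1 else 0, fun i => ?_, ?_, ?_⟩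
  · dsimp only
    split_ifs <;> simp
  · ext i
    simp only [posSet, Finset.mem_filter, Finset.mem_univ, true_and]
    split_ifs <;> norm_num [*]
  · ext i
    have hi : i ∈ S₁ → i ∉ S₂ := fun h₁ => Finset.disjoint_left.1 h h₁
    simp only [negSet, Finset.mem_filter, Finset.mem_univ, true_and]
    split_ifs with h₁ h₂
    · norm_num [hi h₁]
    · simp [h₂]
    · norm_num [h₂]

theorem convex_setOf_sum_mul_le {n : ℕ} (π : Fin n → ℝ) :
    Convex ℝ {p : (Fin n → ℝ) × ℝ | ∑ i, π i * p.1 i ≤ p.2} := by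
  intro p hp q hq a b ha hb _
  simp only [Set.mem_ofPred_eq] at hp hq ⊢
  calc ∑ i, π i * (a • p + b • q).1 i
      = a * ∑ i, π i * p.1 i + b * ∑ i, π i * q.1 i := by
        simp only [Finset.mul_sum, ← Finset.sum_add_distrib]
        refine Finset.sum_congr rfl fun i _ => ?_
        simp only [Prod.fst_add, Prod.smul_fst, Pi.add_apply, Pi.smul_apply, smul_eq_mul]
        ring
    _ ≤ a * p.2 + b * q.2 := by gcongr

/-- `π·x ≤ z` holds on all of `Q_f` iff `π ∈ P_f`. -/
theorem stmt0 (n : ℕ) (hn : 0 < n) (f : Finset (Fin n) → Finset (Fin n) → ℝ)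
    (hf : Bisubmodular n f) (hf0 : f ∅ ∅ = 0) (π : Fin n → ℝ) :
    (∀ p ∈ epigraphQ n f, ∑ i, π i * p.1 i ≤ p.2) ↔ π ∈ bisubPolyhedron n f := by
  constructor
  · intro h S₁ S₂ hS
    obtain ⟨x, hx, rfl, rfl⟩ := exists_isTernary_of_disjoint hS
    rw [← sum_mul_eq_of_isTernary hx]
    exact h (x, f (posSet n x) (negSet n x)) (subset_convexHull ℝ _ ⟨hx, le_rfl⟩)
  · intro h p hp
    refine convexHull_min ?_ (convex_setOf_sum_mul_le π) hp
    rintro q ⟨hq, hfq⟩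
    rw [Set.mem_ofPred_eq, sum_mul_eq_of_isTernary hq]
    exact (h _ _ (disjoint_posSet_negSet n q.1)).trans hfq
end

section
/- Let f : 3^N → ℝ be a bisubmodular function with f(∅,∅) = 0. Then Q_f, the convex hull of {(x,z) ∈ {−1,0,1}^n × ℝ : f(x) ≤ z}, equals the set of all (x,z) ∈ ℝ^n × ℝ such that −1 ≤ x_i ≤ 1 for all i ∈ N and π·x ≤ z for every π in the bisubmodular polyhedron P_f. -/
open Finset

/-- Greedy primal-dual pair for a submodular set function `F` and weights `y` with values in
`[0, 1]`: a vector `π` in the base polytope of `F` on `s`, and a convex combination of subsets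
representing `y` on `s` at which `π` is tight. -/
theorem exists_greedy_of_submodular {ι : Type*} [Fintype ι] [DecidableEq ι]
    (F : Finset ι → ℝ) (hF : ∀ S T, F (S ∩ T) + F (S ∪ T) ≤ F S + F T) (hF0 : F ∅ = 0)
    (y : ι → ℝ) (hy0 : ∀ i, 0 ≤ y i) (hy1 : ∀ i, y i ≤ 1) (s : Finset ι) :
    ∃ (π : ι → ℝ) (w : Finset ι → ℝ),
      (∀ T ⊆ s, ∑ i ∈ T, π i ≤ F T) ∧ ∑ i ∈ s, π i = F s ∧
      (∀ T, 0 ≤ w T) ∧ ∑ T, w T = 1 ∧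
      (∀ i, ∑ T, w T * (if i ∈ T then 1 else 0) = if i ∈ s then y i else 0) ∧
      ∑ T, w T * F T = ∑ i ∈ s, π i * y i ∧
      ∀ c ≤ 1, (∀ i ∈ s, c ≤ y i) → c ≤ w s := by
  induction s using Finset.induction_on_min_value y with
  | empty =>
    refine ⟨0, Pi.single ∅ 1, ?_, by simp [hF0], ?_, by simp, ?_, ?_, ?_⟩
    · intro T hT
      simp [Finset.subset_empty.mp hT, hF0]
    · intro T
      by_cases h : T = ∅ <;> simp [h]
    · intro i
      rw [Finset.sum_eq_single ∅] <;> simp +contextual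
    · simp [Pi.single_apply, hF0]
    · intro c hc _
      simpa using hc
  | insert a s ha hmin ih =>
    obtain ⟨π, w, hle, heq, hw, hsum, hrep, hval, hlow⟩ := ih
    have hwa : y a ≤ w s := hlow _ (hy1 a) hmin
    have hne : insert a s ≠ s := fun h => ha (h ▸ Finset.mem_insert_self a s)
    have hπ : ∀ T, a ∉ T → ∀ g : ι → ℝ,
        ∑ i ∈ T, Function.update π a (F (insert a s) - F s) i * g i = ∑ i ∈ T, π i * g i := by
      intro T haT g
      refine Finset.sum_congr rfl fun i hi => ?_
      rw [Function.update_of_ne (ne_of_mem_of_not_mem hi haT)]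
    have hπ1 : ∀ T, a ∉ T →
        ∑ i ∈ T, Function.update π a (F (insert a s) - F s) i = ∑ i ∈ T, π i := by
      intro T haT
      simpa using hπ T haT 1
    have hw' : ∀ g : Finset ι → ℝ,
        ∑ T, (w T + y a * ((if T = insert a s then 1 else 0) - if T = s then 1 else 0)) * g T
          = ∑ T, w T * g T + y a * (g (insert a s) - g s) := by
      intro g
      simp [add_mul, mul_assoc, sub_mul, Finset.sum_add_distrib, ← Finset.mul_sum]
    refine ⟨Function.update π a (F (insert a s) - F s),
      fun T => w T + y a * ((if T = insert a s then 1 else 0) - if T = s then 1 else 0),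
      ?_, ?_, ?_, ?_, ?_, ?_, ?_⟩
    · intro T hT
      by_cases haT : a ∈ T
      · have h1 : T ∩ s = T.erase a := by grind
        have h2 : T ∪ s = insert a s := by grind
        have h3 := hF T s
        rw [h1, h2] at h3
        have h4 := hle (T.erase a) (by grind)
        rw [← Finset.add_sum_erase _ _ haT, hπ1 _ (by simp), Function.update_self]
        linarith
      · rw [hπ1 T haT]
        exact hle T (by grind)
    · rw [Finset.sum_insert ha, hπ1 s ha, Function.update_self, heq]
      ring
    · intro T
      have h1 := hw T
      have h2 := hy0 a
      by_cases hT : T = s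
      · subst hT
        simp [hne.symm]
        linarith
      · simp only [hT, if_false]
        split_ifs <;> linarith
    · simpa [hsum] using hw' 1
    · intro i
      rw [hw' fun T => if i ∈ T then 1 else 0, hrep i]
      by_cases hia : i = a
      · subst hia
        simp [ha]
      · simp [hia]
    · rw [hw' F, hval, Finset.sum_insert ha, hπ s ha, Function.update_self]
      ring
    · intro c _ hc
      have h1 := hc a (Finset.mem_insert_self a s)
      have h2 := hw (insert a s)
      simp [hne]
      linarith

/-- Restricting a bisubmodular function to the sets signed according to `P` gives a submodular
function. -/
theorem Bisubmodular.submodular_orthant {n : ℕ} {f : Finset (Fin n) → Finset (Fin n) → ℝ}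
    (hf : Bisubmodular n f) (P S T : Finset (Fin n)) :
    f ((S ∩ T) ∩ P) ((S ∩ T) \ P) + f ((S ∪ T) ∩ P) ((S ∪ T) \ P) ≤
      f (S ∩ P) (S \ P) + f (T ∩ P) (T \ P) := by
  have h := hf (S ∩ P) (S \ P) (T ∩ P) (T \ P) (by grind [Finset.disjoint_left])
    (by grind [Finset.disjoint_left])
  convert h using 3 <;> grind

/-- A vector in the base polytope of the restriction of `f` to the orthant given by `P`, with
signs changed outside `P`, lies in the bisubmodular polyhedron of `f`. -/
theorem Bisubmodular.signed_mem_polyhedron {n : ℕ} {f : Finset (Fin n) → Finset (Fin n) → ℝ}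
    (hf : Bisubmodular n f) (P : Finset (Fin n)) (π : Fin n → ℝ)
    (hle : ∀ T, ∑ i ∈ T, π i ≤ f (T ∩ P) (T \ P))
    (heq : ∑ i, π i = f P Pᶜ) :
    (fun i => (if i ∈ P then 1 else -1) * π i) ∈ bisubPolyhedron n f := by
  intro A B hAB
  have h := hf A B P Pᶜ hAB disjoint_compl_right
  have hC := hle ((A ∩ P) ∪ (B \ P))
  have hE := hle ((A \ P) ∪ (B ∩ P))ᶜ
  have e1 : ((A ∩ P) ∪ (B \ P)) ∩ P = A ∩ P := by grind [Finset.mem_compl]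
  have e2 : ((A ∩ P) ∪ (B \ P)) \ P = B ∩ Pᶜ := by grind [Finset.mem_compl]
  have hd := Finset.disjoint_left.mp hAB
  have e3 : ((A \ P) ∪ (B ∩ P))ᶜ ∩ P = (A ∪ P) \ (B ∪ Pᶜ) := by grind [Finset.mem_compl]
  have e4 : ((A \ P) ∪ (B ∩ P))ᶜ \ P = (B ∪ Pᶜ) \ (A ∪ P) := by grind [Finset.mem_compl]
  rw [e1, e2] at hC
  rw [e3, e4] at hE
  have key : ∑ i ∈ A, (if i ∈ P then 1 else -1) * π i - ∑ i ∈ B, (if i ∈ P then 1 else -1) * π i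
      = ∑ i ∈ (A ∩ P) ∪ (B \ P), π i + ∑ i ∈ ((A \ P) ∪ (B ∩ P))ᶜ, π i - ∑ i, π i := by
    have hind : ∀ (S : Finset (Fin n)) (g : Fin n → ℝ),
        ∑ i ∈ S, g i = ∑ i, if i ∈ S then g i else 0 := fun S g => by simp
    rw [hind A, hind B, hind (_ ∪ _), hind _ᶜ, ← Finset.sum_add_distrib,
      ← Finset.sum_sub_distrib, ← Finset.sum_sub_distrib]
    refine Finset.sum_congr rfl fun i _ => ?_
    have hi := @hd i
    by_cases h1 : i ∈ A <;> by_cases h2 : i ∈ B <;> by_cases h3 : i ∈ P <;>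
      simp_all
  linarith

/-- `Q_f` is described by the trivial inequalities together with
all poly-bimatroid inequalities. -/
theorem stmt4 (n : ℕ) (hn : 0 < n) (f : Finset (Fin n) → Finset (Fin n) → ℝ)
    (hf : Bisubmodular n f) (hf0 : f ∅ ∅ = 0) :
    epigraphQ n f =
      {p : (Fin n → ℝ) × ℝ |
        (∀ i, -1 ≤ p.1 i ∧ p.1 i ≤ 1) ∧
        ∀ π ∈ bisubPolyhedron n f, ∑ i, π i * p.1 i ≤ p.2} := by
  apply Set.Subset.antisymm
  · refine convexHull_min ?_ ?_
    · rintro ⟨x, z⟩ ⟨hx, hz⟩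
      refine ⟨fun i => ?_, fun π hπ => ?_⟩
      · rcases hx i with h | h | h <;> simp only at h ⊢ <;> norm_num [h]
      · refine le_trans ?_ hz
        rw [sum_mul_eq_of_isTernary hx]
        refine hπ _ _ (Finset.disjoint_left.mpr fun i h1 h2 => ?_)
        simp only [posSet, negSet, Finset.mem_filter] at h1 h2
        linarith
    · rintro ⟨x, z⟩ ⟨hx, hz⟩ ⟨x', z'⟩ ⟨hx', hz'⟩ a b ha hb hab
      refine ⟨fun i => ?_, fun π hπ => ?_⟩
      · have h1 := hx i
        have h2 := hx' i
        simp only [Prod.fst_add, Prod.smul_fst, Pi.add_apply, Pi.smul_apply, smul_eq_mul] at *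
        constructor <;> nlinarith
      · have h1 := mul_le_mul_of_nonneg_left (hz π hπ) ha
        have h2 := mul_le_mul_of_nonneg_left (hz' π hπ) hb
        rw [Finset.mul_sum] at h1 h2
        refine le_trans (le_of_eq ?_) (add_le_add h1 h2)
        rw [← Finset.sum_add_distrib]
        refine Finset.sum_congr rfl fun i _ => ?_
        simp only [Prod.fst_add, Prod.smul_fst, Pi.add_apply, Pi.smul_apply, smul_eq_mul]
        ring
  · rintro ⟨x, z⟩ ⟨hx, hz⟩
    set P : Finset (Fin n) := Finset.univ.filter (fun i => 0 ≤ x i) with hP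
    obtain ⟨π, w, hle, heq, hw, hsum, hrep, hval, -⟩ := exists_greedy_of_submodular
      (fun T => f (T ∩ P) (T \ P)) (hf.submodular_orthant P) (by simpa using hf0)
      (fun i => |x i|) (fun i => abs_nonneg _) (fun i => abs_le.mpr (hx i)) Finset.univ
    have hsign : ∀ i, (if i ∈ P then 1 else -1) * |x i| = x i := by
      intro i
      by_cases h : 0 ≤ x i
      · simp [hP, h, abs_of_nonneg h]
      · simp [hP, h, abs_of_neg (not_le.mp h)]
    have hπ := hf.signed_mem_polyhedron P π (fun T => hle T (Finset.subset_univ T))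
      (by simpa [Finset.compl_eq_univ_sdiff] using heq)
    have hπz := hz _ hπ
    have hslack : ∑ i, π i * |x i| ≤ z := by
      refine le_trans (le_of_eq (Finset.sum_congr rfl fun i _ => ?_)) hπz
      simp only
      by_cases h : 0 ≤ x i
      · simp [hP, h, abs_of_nonneg h]
      · simp [hP, h, abs_of_neg (not_le.mp h)]
    set d := z - ∑ i, π i * |x i| with hd
    let v : Finset (Fin n) → Fin n → ℝ := fun T i =>
      (if i ∈ P then 1 else -1) * (if i ∈ T then 1 else 0)
    have hcomb : ((x, z) : (Fin n → ℝ) × ℝ) =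
        ∑ T, w T • ((v T, f (T ∩ P) (T \ P) + d) : (Fin n → ℝ) × ℝ) := by
      refine Prod.ext ?_ ?_
      · rw [Prod.fst_sum]
        funext i
        have h := hrep i
        simp only [Finset.mem_univ, if_true] at h
        simp only [Finset.sum_apply, Prod.smul_fst, Pi.smul_apply, smul_eq_mul, v,
          mul_left_comm (w _)]
        rw [← Finset.mul_sum, h, hsign]
      · rw [Prod.snd_sum]
        simp only [Prod.smul_snd, smul_eq_mul, mul_add, Finset.sum_add_distrib]
        rw [hval, ← Finset.sum_mul, hsum, hd]
        ring
    rw [hcomb]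
    refine (convex_convexHull ℝ _).sum_mem (fun T _ => hw T) hsum fun T _ =>
      subset_convexHull ℝ _ ⟨fun i => ?_, ?_⟩
    · simp only [v]
      split_ifs <;> norm_num
    · have hpos : posSet n (v T) = T ∩ P := by
        ext i
        by_cases h1 : i ∈ P <;> by_cases h2 : i ∈ T <;> norm_num [posSet, v, h1, h2]
      have hneg : negSet n (v T) = T \ P := by
        ext i
        by_cases h1 : i ∈ P <;> by_cases h2 : i ∈ T <;> norm_num [negSet, v, h1, h2]
      simp only [hpos, hneg]
      linarith
end

section
/- Let f : 3^N → ℝ be a bisubmodular function with f(∅,∅) = 0. Then the affine span of the set {(x,z) ∈ {−1,0,1}^n × ℝ : f(x) ≤ z} is all of ℝ^n × ℝ; that is, the convex hull Q_f of the epigraph of f is full-dimensional of dimension n+1. -/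
open Finset

/-- The epigraph of any real function on a set containing the origin and the standard basis
vectors affinely spans the whole space. -/
theorem affineSpan_epigraph_eq_top {ι : Type*} [Fintype ι] [DecidableEq ι] (T : Set (ι → ℝ))
    (g : (ι → ℝ) → ℝ) (h0 : (0 : ι → ℝ) ∈ T) (h1 : ∀ i, Pi.single i (1 : ℝ) ∈ T) :
    affineSpan ℝ {p : (ι → ℝ) × ℝ | p.1 ∈ T ∧ g p.1 ≤ p.2} = ⊤ := by
  set S : Set ((ι → ℝ) × ℝ) := {p | p.1 ∈ T ∧ g p.1 ≤ p.2} with hS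
  have base : ((0 : ι → ℝ), g 0) ∈ S := ⟨h0, le_rfl⟩
  have hsub : ∀ p ∈ S, p - (0, g 0) ∈ vectorSpan ℝ S := fun p hp =>
    vsub_mem_vectorSpan ℝ hp base
  have hvert : ((0 : ι → ℝ), (1 : ℝ)) ∈ vectorSpan ℝ S := by
    have hmem : ((0 : ι → ℝ), g 0 + 1) ∈ S := ⟨h0, by simp⟩
    simpa using hsub _ hmem
  have hline : ∀ c : ℝ, ((0 : ι → ℝ), c) ∈ vectorSpan ℝ S := fun c => by
    simpa using (vectorSpan ℝ S).smul_mem c hvert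
  have hbasis : ∀ i, ((Pi.single i 1 : ι → ℝ), (0 : ℝ)) ∈ vectorSpan ℝ S := fun i => by
    have hmem : ((Pi.single i 1 : ι → ℝ), g (Pi.single i 1)) ∈ S := ⟨h1 i, le_rfl⟩
    simpa using (vectorSpan ℝ S).sub_mem (hsub _ hmem) (hline (g (Pi.single i 1) - g 0))
  have htop : vectorSpan ℝ S = ⊤ := by
    refine Submodule.eq_top_iff'.2 fun ⟨x, c⟩ => ?_
    have hx : (x, (0 : ℝ)) = ∑ i, x i • ((Pi.single i 1 : ι → ℝ), (0 : ℝ)) := by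
      ext j
      · simp [Prod.fst_sum, Finset.sum_apply, Pi.single_apply]
      · simp [Prod.snd_sum]
    have hxmem : (x, (0 : ℝ)) ∈ vectorSpan ℝ S := by
      rw [hx]
      exact Submodule.sum_mem _ fun i _ => Submodule.smul_mem _ _ (hbasis i)
    simpa using (vectorSpan ℝ S).add_mem hxmem (hline c)
  exact (AffineSubspace.affineSpan_eq_top_iff_vectorSpan_eq_top_of_nonempty ℝ _ _ ⟨_, base⟩).2 htop

/-- the epigraph of `f` affinely spans `ℝⁿ × ℝ`, i.e. `Q_f` is
full-dimensional of dimension `n+1`. -/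
theorem stmt5 (n : ℕ) (hn : 0 < n) (f : Finset (Fin n) → Finset (Fin n) → ℝ)
    (hf : Bisubmodular n f) (hf0 : f ∅ ∅ = 0) :
    affineSpan ℝ {p : (Fin n → ℝ) × ℝ |
      IsTernary n p.1 ∧ f (posSet n p.1) (negSet n p.1) ≤ p.2} = ⊤ := by
  refine affineSpan_epigraph_eq_top {x | IsTernary n x}
    (fun x => f (posSet n x) (negSet n x)) (fun i => Or.inr (Or.inl rfl)) fun i j => ?_
  by_cases h : j = i
  · subst h
    simp
  · simp [h]
end

section
/- Let f : 3^N → ℝ be a bisubmodular function with f(∅,∅) = 0 and let π be an extreme point of the bisubmodular polyhedron P_f. Then there exist n+1 affinely independent points (x¹,z¹),…,(x^{n+1},z^{n+1}) with each xᵏ ∈ {−1,0,1}^n, f(xᵏ) ≤ zᵏ, and π·xᵏ = zᵏ for all k. In particular, the face of Q_f defined by the inequality π·x ≤ z has dimension n, i.e., the extremal poly-bimatroid inequality π·x ≤ z is facet-defining for Q_f. -/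
open Finset

/-- The sign vector of a pair of finite sets: `1` on the first, `-1` on the second. -/
def signVec {n : ℕ} (A B : Finset (Fin n)) : Fin n → ℝ :=
  fun i => (if i ∈ A then 1 else 0) - (if i ∈ B then 1 else 0)

lemma sum_mul_signVec {n : ℕ} (π : Fin n → ℝ) (A B : Finset (Fin n)) :
    ∑ i, π i * signVec A B i = ∑ i ∈ A, π i - ∑ j ∈ B, π j := by
  simp [signVec, mul_sub, Finset.sum_sub_distrib]

lemma isTernary_signVec {n : ℕ} (A B : Finset (Fin n)) : IsTernary n (signVec A B) := by
  intro i
  by_cases hA : i ∈ A <;> by_cases hB : i ∈ B <;> simp [signVec, hA, hB]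

lemma posSet_signVec {n : ℕ} {A B : Finset (Fin n)} (h : Disjoint A B) :
    posSet n (signVec A B) = A := by
  ext i
  rw [posSet, Finset.mem_filter]
  have : i ∈ A → i ∉ B := fun hi => Finset.disjoint_left.mp h hi
  by_cases hA : i ∈ A <;> by_cases hB : i ∈ B <;>
    first | exact absurd hB (this hA) | norm_num [signVec, hA, hB]

lemma negSet_signVec {n : ℕ} {A B : Finset (Fin n)} (h : Disjoint A B) :
    negSet n (signVec A B) = B := by
  ext i
  rw [negSet, Finset.mem_filter]
  have : i ∈ A → i ∉ B := fun hi => Finset.disjoint_left.mp h hi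
  by_cases hA : i ∈ A <;> by_cases hB : i ∈ B <;>
    first | exact absurd hB (this hA) | norm_num [signVec, hA, hB]

/-- The sign vectors of the constraints of `P_f` that are tight at `π`. -/
def tightVecs {n : ℕ} (f : Finset (Fin n) → Finset (Fin n) → ℝ) (π : Fin n → ℝ) :
    Set (Fin n → ℝ) :=
  {x | ∃ A B : Finset (Fin n), Disjoint A B ∧ signVec A B = x ∧
    ∑ i, π i * signVec A B i = f A B}

/-- A direction orthogonal to all tight constraints can be followed for a small time. -/
lemma eventually_add_smul_mem_bisubPolyhedron {n : ℕ}
    {f : Finset (Fin n) → Finset (Fin n) → ℝ} {π d : Fin n → ℝ}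
    (hπ : π ∈ bisubPolyhedron n f) (hd : ∀ x ∈ tightVecs f π, ∑ i, d i * x i = 0) :
    ∀ᶠ ε : ℝ in nhds 0, π + ε • d ∈ bisubPolyhedron n f := by
  have key : ∀ ε : ℝ, ∀ A B : Finset (Fin n), ∑ i, (π + ε • d) i * signVec A B i =
      ∑ i, π i * signVec A B i + ε * ∑ i, d i * signVec A B i := by
    intro ε A B
    rw [Finset.mul_sum, ← Finset.sum_add_distrib]
    refine Finset.sum_congr rfl fun i _ => ?_
    simp only [Pi.add_apply, Pi.smul_apply, smul_eq_mul]
    ring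
  simp only [bisubPolyhedron, Set.mem_ofPred_eq, ← sum_mul_signVec, key] at hπ ⊢
  rw [Filter.eventually_all]
  intro A
  rw [Filter.eventually_all]
  intro B
  rw [Filter.eventually_imp_distrib_left]
  intro hAB
  rcases (hπ A B hAB).eq_or_lt with h | h
  · simp [h, hd _ ⟨A, B, hAB, rfl, h⟩]
  · have hc : Continuous fun ε : ℝ =>
        ∑ i, π i * signVec A B i + ε * ∑ i, d i * signVec A B i := by fun_prop
    have h0 := hc.tendsto 0
    simp only [zero_mul, add_zero] at h0
    exact (h0.eventually_lt_const h).mono fun ε hε => hε.le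

lemma span_tightVecs_of_mem_extremePoints {n : ℕ}
    {f : Finset (Fin n) → Finset (Fin n) → ℝ} {π : Fin n → ℝ}
    (hπ : π ∈ (bisubPolyhedron n f).extremePoints ℝ) :
    Submodule.span ℝ (tightVecs f π) = ⊤ := by
  by_contra hne
  obtain ⟨φ, hφ, hker⟩ := Submodule.exists_le_ker_of_lt_top _ (lt_top_iff_ne_top.mpr hne)
  set d : Fin n → ℝ := fun i => φ (Pi.single i 1) with hd
  have hφd : ∀ x, φ x = ∑ i, d i * x i := by
    intro x
    rw [LinearMap.pi_apply_eq_sum_univ φ x]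
    refine Finset.sum_congr rfl fun i _ => ?_
    rw [smul_eq_mul, mul_comm, hd]
    congr 2
    ext j
    simp [Pi.single_apply, eq_comm]
  have hev := eventually_add_smul_mem_bisubPolyhedron hπ.1 (d := d) fun x hx => by
    rw [← hφd]
    exact hker (Submodule.subset_span hx)
  have hev' : ∀ᶠ ε : ℝ in nhds 0, π + (-ε) • d ∈ bisubPolyhedron n f := by
    have : Filter.Tendsto (fun ε : ℝ => -ε) (nhds 0) (nhds 0) := by
      simpa using (continuous_neg (G := ℝ)).tendsto 0
    exact this.eventually hev
  obtain ⟨ε, ⟨h₁, h₂⟩, hε⟩ :=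
    (((hev.and hev').filter_mono nhdsWithin_le_nhds).and
      (self_mem_nhdsWithin (a := (0 : ℝ)) (s := Set.Ioi 0))).exists
  have hmid : π ∈ openSegment ℝ (π + ε • d) (π + (-ε) • d) := by
    refine ⟨1 / 2, 1 / 2, by norm_num, by norm_num, by norm_num, ?_⟩
    module
  have heq : π + ε • d = π := hπ.2 h₁ h₂ hmid
  have hd0 : d = 0 := by
    rw [add_eq_left] at heq
    exact (smul_eq_zero.mp heq).resolve_left (ne_of_gt hε)
  exact hφ (LinearMap.ext fun x => by simp [hφd, hd0])

lemma LinearIndependent.affineIndependent_cons_zero {n : ℕ} {V : Type*} [AddCommGroup V]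
    [Module ℝ V] {b : Fin n → V} (hb : LinearIndependent ℝ b) :
    AffineIndependent ℝ (Fin.cons 0 b : Fin (n + 1) → V) := by
  rw [affineIndependent_iff_linearIndependent_vsub ℝ _ 0,
    ← linearIndependent_equiv (finSuccAboveEquiv (0 : Fin (n + 1)))]
  have : ((fun i : { x : Fin (n + 1) // x ≠ 0 } =>
      (Fin.cons 0 b : Fin (n + 1) → V) i -ᵥ (Fin.cons 0 b : Fin (n + 1) → V) 0) ∘
      finSuccAboveEquiv (0 : Fin (n + 1))) = b := by
    ext i
    simp [finSuccAboveEquiv_apply]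
  rwa [this]

/-- each extremal poly-bimatroid inequality is facet-defining:
there are `n+1` affinely independent points of the epigraph on its face. -/
theorem stmt6 (n : ℕ) (hn : 0 < n) (f : Finset (Fin n) → Finset (Fin n) → ℝ)
    (hf : Bisubmodular n f) (hf0 : f ∅ ∅ = 0) (π : Fin n → ℝ)
    (hπ : π ∈ (bisubPolyhedron n f).extremePoints ℝ) :
    ∃ p : Fin (n + 1) → (Fin n → ℝ) × ℝ,
      AffineIndependent ℝ p ∧
      ∀ k, IsTernary n (p k).1 ∧ f (posSet n (p k).1) (negSet n (p k).1) ≤ (p k).2 ∧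
        ∑ i, π i * (p k).1 i = (p k).2 := by
  obtain ⟨b, hbT, hb⟩ : ∃ b : Fin n → Fin n → ℝ,
      (∀ i, b i ∈ tightVecs f π) ∧ LinearIndependent ℝ b := by
    have hrank : Module.finrank ℝ (Submodule.span ℝ (tightVecs f π)) = n := by
      rw [span_tightVecs_of_mem_extremePoints hπ, finrank_top, Module.finrank_fin_fun]
    have h := Submodule.exists_fun_fin_finrank_span_eq ℝ (tightVecs f π)
    rw [hrank] at h
    obtain ⟨b, hbT, -, hb⟩ := h
    exact ⟨b, hbT, hb⟩
  have hzero : (0 : Fin n → ℝ) ∈ tightVecs f π :=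
    ⟨∅, ∅, Finset.disjoint_empty_left _, by ext; simp [signVec], by simp [signVec, hf0]⟩
  have hmem : ∀ k, (Fin.cons 0 b : Fin (n + 1) → Fin n → ℝ) k ∈ tightVecs f π :=
    Fin.cases hzero hbT
  refine ⟨fun k => ((Fin.cons 0 b : Fin (n + 1) → Fin n → ℝ) k,
    ∑ i, π i * (Fin.cons 0 b : Fin (n + 1) → Fin n → ℝ) k i), ?_, fun k => ?_⟩
  · exact AffineIndependent.of_comp (LinearMap.fst ℝ (Fin n → ℝ) ℝ).toAffineMap
      hb.affineIndependent_cons_zero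
  · obtain ⟨A, B, hAB, hx, ht⟩ := hmem k
    simp only [← hx]
    refine ⟨isTernary_signVec A B, ?_, trivial⟩
    rw [posSet_signVec hAB, negSet_signVec hAB, ht]
end

section
/- Let f : 3^N → ℝ be a bisubmodular function with f(∅,∅) = 0, let δ be a permutation of N, and let σ ∈ {−1,1}^n. Then the signed greedy vector π^{δ,σ} belongs to the bisubmodular polyhedron P_f, and it satisfies its defining inequality for the final pair (S₁ⁿ, S₂ⁿ) with equality: Σ_{i∈S₁ⁿ} π^{δ,σ}_i − Σ_{j∈S₂ⁿ} π^{δ,σ}_j = f(S₁ⁿ, S₂ⁿ). -/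
open Finset

theorem mem_greedyS1 {n : ℕ} {δ : Equiv.Perm (Fin n)} {σ : Fin n → ℝ} {k : ℕ} {i : Fin n} :
    i ∈ greedyS1 n δ σ k ↔ (δ.symm i : ℕ) < k ∧ σ i = 1 := by
  simp only [greedyS1, Finset.mem_image, Finset.mem_filter, Finset.mem_univ, true_and]
  exact ⟨by rintro ⟨j, hj, rfl⟩; simpa using hj, fun h => ⟨δ.symm i, by simpa using h, by simp⟩⟩

theorem mem_greedyS2 {n : ℕ} {δ : Equiv.Perm (Fin n)} {σ : Fin n → ℝ} {k : ℕ} {i : Fin n} :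
    i ∈ greedyS2 n δ σ k ↔ (δ.symm i : ℕ) < k ∧ σ i = -1 := by
  simp only [greedyS2, Finset.mem_image, Finset.mem_filter, Finset.mem_univ, true_and]
  exact ⟨by rintro ⟨j, hj, rfl⟩; simpa using hj, fun h => ⟨δ.symm i, by simpa using h, by simp⟩⟩

theorem disjoint_greedyS1_greedyS2 (n : ℕ) (δ : Equiv.Perm (Fin n)) (σ : Fin n → ℝ) (k : ℕ) :
    Disjoint (greedyS1 n δ σ k) (greedyS2 n δ σ k) := by
  rw [Finset.disjoint_left]
  intro i h1 h2
  rw [mem_greedyS1] at h1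
  rw [mem_greedyS2] at h2
  linarith [h1.2, h2.2]

/-- Signed sums are modular with respect to the bisubmodular operations. -/
theorem signed_sum_inter_add_reduced_union {ι : Type*} [Fintype ι] [DecidableEq ι] (π : ι → ℝ)
    {X₁ X₂ Y₁ Y₂ : Finset ι} (hX : Disjoint X₁ X₂) (hY : Disjoint Y₁ Y₂) :
    ((∑ i ∈ X₁ ∩ Y₁, π i) - ∑ i ∈ X₂ ∩ Y₂, π i) +
        ((∑ i ∈ (X₁ ∪ Y₁) \ (X₂ ∪ Y₂), π i) - ∑ i ∈ (X₂ ∪ Y₂) \ (X₁ ∪ Y₁), π i) =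
      ((∑ i ∈ X₁, π i) - ∑ i ∈ X₂, π i) + ((∑ i ∈ Y₁, π i) - ∑ i ∈ Y₂, π i) := by
  have key : ∀ S : Finset ι, ∑ i ∈ S, π i = ∑ i, if i ∈ S then π i else 0 := by simp
  simp only [key, ← Finset.sum_sub_distrib, ← Finset.sum_add_distrib]
  refine Finset.sum_congr rfl fun i _ => ?_
  rw [Finset.disjoint_left] at hX hY
  have hXi := @hX i
  have hYi := @hY i
  by_cases h1 : i ∈ X₁ <;> by_cases h2 : i ∈ X₂ <;> by_cases h3 : i ∈ Y₁ <;>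
    by_cases h4 : i ∈ Y₂ <;> simp_all

/-- Subtracting a signed sum preserves bisubmodularity. -/
theorem Bisubmodular.sub_signed_sum {n : ℕ} {f : Finset (Fin n) → Finset (Fin n) → ℝ}
    (hf : Bisubmodular n f) (π : Fin n → ℝ) :
    Bisubmodular n fun S₁ S₂ => f S₁ S₂ - ((∑ i ∈ S₁, π i) - ∑ i ∈ S₂, π i) := by
  intro X₁ X₂ Y₁ Y₂ hX hY
  have h := hf X₁ X₂ Y₁ Y₂ hX hY
  have h' := signed_sum_inter_add_reduced_union π hX hY
  dsimp only
  linarith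

/-- The signed greedy vector is tight on every pair of the greedy chain. -/
theorem signedGreedy_tight {n : ℕ} {f : Finset (Fin n) → Finset (Fin n) → ℝ} (hf0 : f ∅ ∅ = 0)
    (δ : Equiv.Perm (Fin n)) {σ : Fin n → ℝ} (hσ : ∀ i, σ i = 1 ∨ σ i = -1) {k : ℕ}
    (hk : k ≤ n) :
    (∑ i ∈ greedyS1 n δ σ k, signedGreedy n f δ σ i) -
      (∑ j ∈ greedyS2 n δ σ k, signedGreedy n f δ σ j) =
      f (greedyS1 n δ σ k) (greedyS2 n δ σ k) := by
  induction k with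
  | zero => simp [greedyS1, greedyS2, hf0]
  | succ k ih =>
    have ih := ih (by omega)
    obtain ⟨e, he⟩ : ∃ e, δ.symm e = (⟨k, hk⟩ : Fin n) := ⟨δ ⟨k, hk⟩, by simp⟩
    have hlt : ∀ i, (δ.symm i : ℕ) < k + 1 ↔ i = e ∨ (δ.symm i : ℕ) < k := by
      intro i
      rw [← δ.symm.injective.eq_iff, he, Fin.ext_iff]
      simp only
      omega
    have hek : ¬ (δ.symm e : ℕ) < k := by simp [he]
    have hπ : signedGreedy n f δ σ e = σ e *
        (f (greedyS1 n δ σ (k + 1)) (greedyS2 n δ σ (k + 1)) -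
          f (greedyS1 n δ σ k) (greedyS2 n δ σ k)) := by
      simp only [signedGreedy, he]
    have hn1 : e ∉ greedyS1 n δ σ k := fun h => hek (mem_greedyS1.1 h).1
    have hn2 : e ∉ greedyS2 n δ σ k := fun h => hek (mem_greedyS2.1 h).1
    rcases hσ e with h | h
    · have h1 : greedyS1 n δ σ (k + 1) = insert e (greedyS1 n δ σ k) := by
        ext i
        simp only [Finset.mem_insert, mem_greedyS1, hlt]
        grind
      have h2 : greedyS2 n δ σ (k + 1) = greedyS2 n δ σ k := by
        ext i
        simp only [mem_greedyS2, hlt]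
        grind
      rw [h] at hπ
      have hs := Finset.sum_insert (f := signedGreedy n f δ σ) hn1
      rw [← h1] at hs
      have hs' := congrArg (fun S => ∑ i ∈ S, signedGreedy n f δ σ i) h2
      linarith
    · have h1 : greedyS2 n δ σ (k + 1) = insert e (greedyS2 n δ σ k) := by
        ext i
        simp only [Finset.mem_insert, mem_greedyS2, hlt]
        grind
      have h2 : greedyS1 n δ σ (k + 1) = greedyS1 n δ σ k := by
        ext i
        simp only [mem_greedyS1, hlt]
        grind
      rw [h] at hπ
      have hs := Finset.sum_insert (f := signedGreedy n f δ σ) hn2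
      rw [← h1] at hs
      have hs' := congrArg (fun S => ∑ i ∈ S, signedGreedy n f δ σ i) h2
      linarith

/-- A bisubmodular function vanishing on the greedy chain is nonnegative. -/
theorem Bisubmodular.nonneg_of_greedy_eq_zero {n : ℕ} {g : Finset (Fin n) → Finset (Fin n) → ℝ}
    (hg : Bisubmodular n g) (δ : Equiv.Perm (Fin n)) {σ : Fin n → ℝ}
    (hσ : ∀ i, σ i = 1 ∨ σ i = -1)
    (h0 : ∀ k ≤ n, g (greedyS1 n δ σ k) (greedyS2 n δ σ k) = 0)
    {X₁ X₂ : Finset (Fin n)} (hX : Disjoint X₁ X₂) : 0 ≤ g X₁ X₂ := by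
  suffices H : ∀ k ≤ n, ∀ X₁ X₂ : Finset (Fin n), Disjoint X₁ X₂ →
      (∀ i, i ∈ X₁ ∨ i ∈ X₂ → (δ.symm i : ℕ) < k) → 0 ≤ g X₁ X₂ from
    H n le_rfl X₁ X₂ hX fun i _ => (δ.symm i).isLt
  clear hX X₁ X₂
  intro k
  induction k with
  | zero =>
    intro _ X₁ X₂ _ hs
    have e1 : X₁ = ∅ := Finset.eq_empty_of_forall_notMem fun i hi => by simpa using hs i (.inl hi)
    have e2 : X₂ = ∅ := Finset.eq_empty_of_forall_notMem fun i hi => by simpa using hs i (.inr hi)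
    have h := h0 0 (Nat.zero_le n)
    simp only [greedyS1, greedyS2, Nat.not_lt_zero, false_and, Finset.filter_false,
      Finset.image_empty] at h
    rw [e1, e2, h]
  | succ k ih =>
    intro hk X₁ X₂ hX hs
    have ih := ih (by omega)
    obtain ⟨e, he⟩ : ∃ e, δ.symm e = (⟨k, hk⟩ : Fin n) := ⟨δ ⟨k, hk⟩, by simp⟩
    have hlt : ∀ i, (δ.symm i : ℕ) < k + 1 ↔ i = e ∨ (δ.symm i : ℕ) < k := by
      intro i
      rw [← δ.symm.injective.eq_iff, he, Fin.ext_iff]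
      simp only
      omega
    have hek : ¬ (δ.symm e : ℕ) < k := by simp [he]
    simp only [hlt] at hs
    have hXl := Finset.disjoint_left.1 hX
    have hk0 := h0 k (by omega)
    have hk1 := h0 (k + 1) hk
    have hdis : ∀ A B : Finset (Fin n), Disjoint (A \ B) (B \ A) := fun A B =>
      disjoint_sdiff_sdiff
    have hdis' : ∀ A B : Finset (Fin n), Disjoint (X₁ ∩ A) (X₂ ∩ B) := fun A B =>
      hX.mono Finset.inter_subset_left Finset.inter_subset_left
    have hAk := disjoint_greedyS1_greedyS2 n δ σ k
    by_cases hopp : (e ∈ X₁ ∧ σ e = -1) ∨ (e ∈ X₂ ∧ σ e = 1)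
    · have h := hg X₁ X₂ _ _ hX (disjoint_greedyS1_greedyS2 n δ σ (k + 1))
      have p1 := ih _ _ (hdis' (greedyS1 n δ σ (k + 1)) (greedyS2 n δ σ (k + 1))) (by
        intro i hi
        simp only [Finset.mem_inter, mem_greedyS1, mem_greedyS2, hlt] at hi
        grind)
      have p2 := ih _ _ (hdis (X₁ ∪ greedyS1 n δ σ (k + 1)) (X₂ ∪ greedyS2 n δ σ (k + 1))) (by
        intro i hi
        simp only [Finset.mem_sdiff, Finset.mem_union, mem_greedyS1, mem_greedyS2, hlt] at hi
        grind)
      linarith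
    by_cases hsame : (e ∈ X₁ ∧ σ e = 1) ∨ (e ∈ X₂ ∧ σ e = -1)
    · have h := hg X₁ X₂ _ _ hX hAk
      have p1 := ih _ _ (hdis' (greedyS1 n δ σ k) (greedyS2 n δ σ k)) (by
        intro i hi
        simp only [Finset.mem_inter, mem_greedyS1, mem_greedyS2] at hi
        grind)
      have hY := hdis (X₁ ∪ greedyS1 n δ σ k) (X₂ ∪ greedyS2 n δ σ k)
      obtain ⟨Y₁, hY₁⟩ : ∃ Y, Y = (X₁ ∪ greedyS1 n δ σ k) \ (X₂ ∪ greedyS2 n δ σ k) := ⟨_, rfl⟩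
      obtain ⟨Y₂, hY₂⟩ : ∃ Y, Y = (X₂ ∪ greedyS2 n δ σ k) \ (X₁ ∪ greedyS1 n δ σ k) := ⟨_, rfl⟩
      rw [← hY₁, ← hY₂] at h hY
      have m1 : ∀ i, i ∈ Y₁ ↔ (i ∈ X₁ ∨ (δ.symm i : ℕ) < k ∧ σ i = 1) ∧
          ¬ (i ∈ X₂ ∨ (δ.symm i : ℕ) < k ∧ σ i = -1) := by
        simp [hY₁, mem_greedyS1, mem_greedyS2]
      have m2 : ∀ i, i ∈ Y₂ ↔ (i ∈ X₂ ∨ (δ.symm i : ℕ) < k ∧ σ i = -1) ∧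
          ¬ (i ∈ X₁ ∨ (δ.symm i : ℕ) < k ∧ σ i = 1) := by
        simp [hY₂, mem_greedyS1, mem_greedyS2]
      have h' := hg Y₁ Y₂ _ _ hY hAk
      have p2 := ih _ _ (hY.mono (Finset.inter_subset_left (s₂ := greedyS1 n δ σ k))
          (Finset.inter_subset_left (s₂ := greedyS2 n δ σ k))) (by
        intro i hi
        simp only [Finset.mem_inter, mem_greedyS1, mem_greedyS2] at hi
        grind)
      have e1 : (Y₁ ∪ greedyS1 n δ σ k) \ (Y₂ ∪ greedyS2 n δ σ k) = greedyS1 n δ σ (k + 1) := by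
        ext i
        simp only [Finset.mem_sdiff, Finset.mem_union, mem_greedyS1, mem_greedyS2, hlt, m1, m2]
        have := hs i
        have := hσ i
        have := @hXl i
        grind
      have e2 : (Y₂ ∪ greedyS2 n δ σ k) \ (Y₁ ∪ greedyS1 n δ σ k) = greedyS2 n δ σ (k + 1) := by
        ext i
        simp only [Finset.mem_sdiff, Finset.mem_union, mem_greedyS1, mem_greedyS2, hlt, m1, m2]
        have := hs i
        have := hσ i
        have := @hXl i
        grind
      rw [e1, e2] at h'
      linarith
    · refine ih X₁ X₂ hX fun i hi => ?_
      have := hs i hi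
      have := hσ e
      grind

/-- the signed greedy vector lies in `P_f` and is tight for the
final pair `(S₁ⁿ, S₂ⁿ)`. -/
theorem stmt7 (n : ℕ) (hn : 0 < n) (f : Finset (Fin n) → Finset (Fin n) → ℝ)
    (hf : Bisubmodular n f) (hf0 : f ∅ ∅ = 0)
    (δ : Equiv.Perm (Fin n)) (σ : Fin n → ℝ) (hσ : ∀ i, σ i = 1 ∨ σ i = -1) :
    signedGreedy n f δ σ ∈ bisubPolyhedron n f ∧
    (∑ i ∈ greedyS1 n δ σ n, signedGreedy n f δ σ i) -
      (∑ j ∈ greedyS2 n δ σ n, signedGreedy n f δ σ j) =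
      f (greedyS1 n δ σ n) (greedyS2 n δ σ n) := by
  have htight : ∀ k ≤ n, _ := fun k hk => signedGreedy_tight (k := k) hf0 δ hσ hk
  refine ⟨fun S₁ S₂ hS => ?_, htight n le_rfl⟩
  exact sub_nonneg.1 ((hf.sub_signed_sum (signedGreedy n f δ σ)).nonneg_of_greedy_eq_zero δ hσ
    (fun k hk => sub_eq_zero.2 (htight k hk).symm) hS)
end

section
/- Let f : 3^N → ℝ be a bisubmodular function with f(∅,∅) = 0. A vector π ∈ ℝ^n is an extreme point of the bisubmodular polyhedron P_f if and only if there exist a permutation δ of N and a sign vector σ ∈ {−1,1}^n such that π is the signed greedy vector π^{δ,σ}. -/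
open Finset

/-- The value of the linear functional of the signed set `(S₁, S₂)` at `p`. -/
def signedSum {n : ℕ} (p : Fin n → ℝ) (S₁ S₂ : Finset (Fin n)) : ℝ :=
  ∑ i ∈ S₁, p i - ∑ i ∈ S₂, p i

/-- The part of `A` on which `σ` takes the value `s`. -/
noncomputable def signPart {n : ℕ} (σ : Fin n → ℝ) (s : ℝ) (A : Finset (Fin n)) :
    Finset (Fin n) :=
  A.filter fun i => σ i = s

/-- The restriction of `f` to the orthant of `σ`, as a set function. -/
noncomputable def orthantFun {n : ℕ} (f : Finset (Fin n) → Finset (Fin n) → ℝ)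
    (σ : Fin n → ℝ) (A : Finset (Fin n)) : ℝ :=
  f (signPart σ 1 A) (signPart σ (-1) A)

/-- The first `k` elements in the order given by `δ`. -/
def permPrefix {n : ℕ} (δ : Equiv.Perm (Fin n)) (k : ℕ) : Finset (Fin n) :=
  univ.filter fun i => (δ.symm i : ℕ) < k

/-- `(S₁, S₂)` is a signed set whose constraint holds with equality at `p`. -/
def IsTight {n : ℕ} (f : Finset (Fin n) → Finset (Fin n) → ℝ) (p : Fin n → ℝ)
    (S₁ S₂ : Finset (Fin n)) : Prop :=
  Disjoint S₁ S₂ ∧ signedSum p S₁ S₂ = f S₁ S₂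

section SignedSets

variable {n : ℕ} {f : Finset (Fin n) → Finset (Fin n) → ℝ} {p σ : Fin n → ℝ}

lemma signedSum_eq_sum (p : Fin n → ℝ) (S₁ S₂ : Finset (Fin n)) :
    signedSum p S₁ S₂ =
      ∑ i, ((if i ∈ S₁ then p i else 0) - (if i ∈ S₂ then p i else 0)) := by
  simp [signedSum, Finset.sum_sub_distrib]

lemma signedSum_inter_add_signedSum_union (p : Fin n → ℝ) {X₁ X₂ Y₁ Y₂ : Finset (Fin n)}
    (hX : Disjoint X₁ X₂) (hY : Disjoint Y₁ Y₂) :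
    signedSum p (X₁ ∩ Y₁) (X₂ ∩ Y₂) +
        signedSum p ((X₁ ∪ Y₁) \ (X₂ ∪ Y₂)) ((X₂ ∪ Y₂) \ (X₁ ∪ Y₁)) =
      signedSum p X₁ X₂ + signedSum p Y₁ Y₂ := by
  simp only [signedSum_eq_sum, ← Finset.sum_add_distrib]
  refine Finset.sum_congr rfl fun i _ => ?_
  have h1 : i ∈ X₁ → i ∉ X₂ := fun h => Finset.disjoint_left.1 hX h
  have h2 : i ∈ Y₁ → i ∉ Y₂ := fun h => Finset.disjoint_left.1 hY h
  by_cases a : i ∈ X₁ <;> by_cases b : i ∈ X₂ <;> by_cases c : i ∈ Y₁ <;>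
    by_cases d : i ∈ Y₂ <;> simp_all

lemma disjoint_signPart (σ : Fin n → ℝ) (A : Finset (Fin n)) :
    Disjoint (signPart σ 1 A) (signPart σ (-1) A) := by
  rw [Finset.disjoint_left]
  intro i h1 h2
  simp only [signPart, Finset.mem_filter] at h1 h2
  linarith [h1.2, h2.2]

lemma disjoint_union_sdiff_union (X₁ X₂ Y₁ Y₂ : Finset (Fin n)) :
    Disjoint ((X₁ ∪ Y₁) \ (X₂ ∪ Y₂)) ((X₂ ∪ Y₂) \ (X₁ ∪ Y₁)) := by
  rw [Finset.disjoint_left]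
  intro i h1 h2
  exact (Finset.mem_sdiff.1 h2).2 (Finset.mem_sdiff.1 h1).1

lemma signedSum_signPart (hσ : ∀ i, σ i = 1 ∨ σ i = -1) (p : Fin n → ℝ)
    (A : Finset (Fin n)) :
    signedSum p (signPart σ 1 A) (signPart σ (-1) A) = ∑ i ∈ A, σ i * p i := by
  rw [signedSum, signPart, signPart, Finset.sum_filter, Finset.sum_filter,
    ← Finset.sum_sub_distrib]
  refine Finset.sum_congr rfl fun i _ => ?_
  rcases hσ i with h | h <;> norm_num [h]

lemma IsTight.inter_union (hf : Bisubmodular n f) (hp : p ∈ bisubPolyhedron n f)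
    {X₁ X₂ Y₁ Y₂ : Finset (Fin n)} (hX : IsTight f p X₁ X₂) (hY : IsTight f p Y₁ Y₂) :
    IsTight f p (X₁ ∩ Y₁) (X₂ ∩ Y₂) ∧
      IsTight f p ((X₁ ∪ Y₁) \ (X₂ ∪ Y₂)) ((X₂ ∪ Y₂) \ (X₁ ∪ Y₁)) := by
  have hd : Disjoint (X₁ ∩ Y₁) (X₂ ∩ Y₂) :=
    hX.1.mono Finset.inter_subset_left Finset.inter_subset_left
  have hd' := disjoint_union_sdiff_union X₁ X₂ Y₁ Y₂
  have h1 : signedSum p (X₁ ∩ Y₁) (X₂ ∩ Y₂) ≤ _ := hp _ _ hd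
  have h2 : signedSum p ((X₁ ∪ Y₁) \ (X₂ ∪ Y₂)) ((X₂ ∪ Y₂) \ (X₁ ∪ Y₁)) ≤ _ := hp _ _ hd'
  have h3 := signedSum_inter_add_signedSum_union p hX.1 hY.1
  have h4 := hf X₁ X₂ Y₁ Y₂ hX.1 hY.1
  have h5 := hX.2
  have h6 := hY.2
  exact ⟨⟨hd, by linarith⟩, ⟨hd', by linarith⟩⟩

lemma signPart_inter (σ : Fin n → ℝ) (s : ℝ) (A B : Finset (Fin n)) :
    signPart σ s A ∩ signPart σ s B = signPart σ s (A ∩ B) :=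
  (Finset.filter_inter_distrib _ A B).symm

lemma signPart_union_sdiff (σ : Fin n → ℝ) {s t : ℝ} (hst : s ≠ t) (A B : Finset (Fin n)) :
    (signPart σ s A ∪ signPart σ s B) \ (signPart σ t A ∪ signPart σ t B) =
      signPart σ s (A ∪ B) := by
  ext i
  simp only [signPart, Finset.mem_sdiff, Finset.mem_union, Finset.mem_filter]
  constructor
  · tauto
  · rintro ⟨h, rfl⟩
    tauto

lemma orthantFun_submodular (hf : Bisubmodular n f) (σ : Fin n → ℝ) (A B : Finset (Fin n)) :
    orthantFun f σ (A ∩ B) + orthantFun f σ (A ∪ B) ≤ orthantFun f σ A + orthantFun f σ B := by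
  have h := hf _ _ _ _ (disjoint_signPart σ A) (disjoint_signPart σ B)
  rwa [signPart_inter, signPart_inter, signPart_union_sdiff σ (by norm_num),
    signPart_union_sdiff σ (by norm_num)] at h

lemma orthantFun_empty (hf0 : f ∅ ∅ = 0) (σ : Fin n → ℝ) : orthantFun f σ ∅ = 0 := by
  simpa [orthantFun, signPart] using hf0

lemma exists_inter_union_eq_signPart (hσ : ∀ i, σ i = 1 ∨ σ i = -1)
    {T₁ T₂ : Finset (Fin n)} (hT : Disjoint T₁ T₂) :
    ∃ A A' : Finset (Fin n),
      T₁ ∩ signPart σ 1 univ = signPart σ 1 A ∧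
      T₂ ∩ signPart σ (-1) univ = signPart σ (-1) A ∧
      (T₁ ∪ signPart σ 1 univ) \ (T₂ ∪ signPart σ (-1) univ) = signPart σ 1 A' ∧
      (T₂ ∪ signPart σ (-1) univ) \ (T₁ ∪ signPart σ 1 univ) = signPart σ (-1) A' := by
  refine ⟨univ.filter fun i => (i ∈ T₁ ∧ σ i = 1) ∨ (i ∈ T₂ ∧ σ i = -1),
    univ.filter fun i => ¬ (i ∈ T₂ ∧ σ i = 1) ∧ ¬ (i ∈ T₁ ∧ σ i = -1), ?_, ?_, ?_, ?_⟩ <;>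
  · ext i
    have h1 : i ∈ T₁ → i ∉ T₂ := fun h => Finset.disjoint_left.1 hT h
    rcases hσ i with h | h <;> norm_num [signPart, h]

lemma mem_bisubPolyhedron_of_orthantFun (hf : Bisubmodular n f)
    (hσ : ∀ i, σ i = 1 ∨ σ i = -1)
    (h : ∀ A, ∑ i ∈ A, σ i * p i ≤ orthantFun f σ A)
    (huniv : ∑ i, σ i * p i = orthantFun f σ univ) : p ∈ bisubPolyhedron n f := by
  intro T₁ T₂ hT
  change signedSum p T₁ T₂ ≤ _
  obtain ⟨A, A', h1, h2, h3, h4⟩ := exists_inter_union_eq_signPart hσ hT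
  have hb := hf _ _ _ _ hT (disjoint_signPart σ univ)
  have hs := signedSum_inter_add_signedSum_union p hT (disjoint_signPart σ univ)
  rw [h1, h2, h3, h4] at hb hs
  simp only [signedSum_signPart hσ] at hs
  have hA := h A
  have hA' := h A'
  unfold orthantFun at *
  linarith

end SignedSets

section Greedy

variable {n : ℕ} {f : Finset (Fin n) → Finset (Fin n) → ℝ} {p σ : Fin n → ℝ}

lemma greedyS1_eq (δ : Equiv.Perm (Fin n)) (σ : Fin n → ℝ) (k : ℕ) :
    greedyS1 n δ σ k = signPart σ 1 (permPrefix δ k) := by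
  ext i
  simp only [greedyS1, signPart, permPrefix, Finset.mem_image, Finset.mem_filter,
    Finset.mem_univ, true_and]
  constructor
  · rintro ⟨j, h, rfl⟩
    simpa using h
  · intro h
    exact ⟨δ.symm i, by simpa using h, by simp⟩

lemma greedyS2_eq (δ : Equiv.Perm (Fin n)) (σ : Fin n → ℝ) (k : ℕ) :
    greedyS2 n δ σ k = signPart σ (-1) (permPrefix δ k) := by
  ext i
  simp only [greedyS2, signPart, permPrefix, Finset.mem_image, Finset.mem_filter,
    Finset.mem_univ, true_and]
  constructor
  · rintro ⟨j, h, rfl⟩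
    simpa using h
  · intro h
    exact ⟨δ.symm i, by simpa using h, by simp⟩

lemma permPrefix_zero (δ : Equiv.Perm (Fin n)) : permPrefix δ 0 = ∅ := by
  simp [permPrefix]

lemma permPrefix_eq_univ (δ : Equiv.Perm (Fin n)) {k : ℕ} (hk : n ≤ k) :
    permPrefix δ k = univ := by
  ext i
  simp [permPrefix, (δ.symm i).isLt.trans_le hk]

lemma notMem_permPrefix (δ : Equiv.Perm (Fin n)) (j : Fin n) : δ j ∉ permPrefix δ j := by
  simp [permPrefix]

lemma permPrefix_succ (δ : Equiv.Perm (Fin n)) (j : Fin n) :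
    permPrefix δ (j + 1) = insert (δ j) (permPrefix δ j) := by
  ext i
  simp only [permPrefix, Finset.mem_insert, Finset.mem_filter, Finset.mem_univ, true_and,
    Order.lt_add_one_iff, le_iff_eq_or_lt, Fin.val_inj, Equiv.symm_apply_eq]

lemma eq_signedGreedy_iff (hf0 : f ∅ ∅ = 0) (δ : Equiv.Perm (Fin n))
    (hσ : ∀ i, σ i = 1 ∨ σ i = -1) :
    p = signedGreedy n f δ σ ↔
      ∀ k, ∑ i ∈ permPrefix δ k, σ i * p i = orthantFun f σ (permPrefix δ k) := by
  have hsq : ∀ i, σ i * σ i = 1 := fun i => by rcases hσ i with h | h <;> simp [h]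
  have hg : ∀ i, signedGreedy n f δ σ i = σ i *
      (orthantFun f σ (permPrefix δ (δ.symm i + 1)) -
        orthantFun f σ (permPrefix δ (δ.symm i))) := by
    intro i
    simp only [signedGreedy, greedyS1_eq, greedyS2_eq, orthantFun]
  constructor
  · rintro rfl k
    induction k with
    | zero => simp [permPrefix_zero, orthantFun_empty hf0]
    | succ k ih =>
      by_cases hk : k < n
      · have hs := permPrefix_succ δ ⟨k, hk⟩
        have hm := notMem_permPrefix δ ⟨k, hk⟩
        have hv := hg (δ ⟨k, hk⟩)
        rw [Equiv.symm_apply_apply] at hv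
        simp only at hs hm hv
        rw [hs, Finset.sum_insert hm, ih, hv, ← mul_assoc, hsq, ← hs]
        ring
      · rw [not_lt] at hk
        rwa [permPrefix_eq_univ δ (hk.trans k.le_succ), ← permPrefix_eq_univ δ hk]
  · intro h
    funext i
    rw [hg, ← h, ← h, permPrefix_succ, Finset.sum_insert (notMem_permPrefix _ _),
      Equiv.apply_symm_apply, add_sub_cancel_right, ← mul_assoc, hsq, one_mul]

lemma sum_le_of_submodular_of_permPrefix {g : Finset (Fin n) → ℝ}
    (hg : ∀ A B, g (A ∩ B) + g (A ∪ B) ≤ g A + g B) {x : Fin n → ℝ}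
    (δ : Equiv.Perm (Fin n)) (hx : ∀ k, ∑ i ∈ permPrefix δ k, x i = g (permPrefix δ k))
    (A : Finset (Fin n)) : ∑ i ∈ A, x i ≤ g A := by
  suffices h : ∀ k, ∀ A ⊆ permPrefix δ k, ∑ i ∈ A, x i ≤ g A from
    h n A (by rw [permPrefix_eq_univ δ le_rfl]; exact Finset.subset_univ A)
  intro k
  induction k with
  | zero =>
    intro A hA
    have h0 := hx 0
    rw [permPrefix_zero] at hA h0
    rw [Finset.subset_empty.1 hA, h0]
  | succ k ih =>
    intro A hA
    by_cases hk : k < n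
    · have hs := permPrefix_succ δ ⟨k, hk⟩
      simp only at hs
      have hu : A ∪ permPrefix δ k = permPrefix δ k ∨
          A ∪ permPrefix δ k = permPrefix δ (k + 1) := by
        by_cases hm : δ ⟨k, hk⟩ ∈ A
        · right
          refine (Finset.union_subset hA (hs ▸ Finset.subset_insert _ _)).antisymm ?_
          rw [hs]
          exact Finset.insert_subset (Finset.mem_union_left _ hm) Finset.subset_union_right
        · left
          rw [Finset.union_eq_right]
          rw [hs] at hA
          exact (Finset.subset_insert_iff_of_notMem hm).1 hA
      have hu' : ∑ i ∈ A ∪ permPrefix δ k, x i = g (A ∪ permPrefix δ k) := by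
        rcases hu with h | h <;> rw [h, hx]
      have h1 := ih (A ∩ permPrefix δ k) Finset.inter_subset_right
      have h2 := hg A (permPrefix δ k)
      have h3 := Finset.sum_union_inter (s₁ := A) (s₂ := permPrefix δ k) (f := x)
      have h4 := hx k
      linarith
    · rw [not_lt] at hk
      rw [permPrefix_eq_univ δ (hk.trans k.le_succ), ← permPrefix_eq_univ δ hk] at hA
      exact ih A hA

lemma signedGreedy_mem_bisubPolyhedron (hf : Bisubmodular n f) (hf0 : f ∅ ∅ = 0)
    (δ : Equiv.Perm (Fin n)) (hσ : ∀ i, σ i = 1 ∨ σ i = -1) :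
    signedGreedy n f δ σ ∈ bisubPolyhedron n f := by
  have h := (eq_signedGreedy_iff hf0 δ hσ).1 rfl
  refine mem_bisubPolyhedron_of_orthantFun hf hσ
    (sum_le_of_submodular_of_permPrefix (orthantFun_submodular hf σ) δ h) ?_
  simpa only [permPrefix_eq_univ δ le_rfl] using h n

lemma sum_le_orthantFun (hp : p ∈ bisubPolyhedron n f) (hσ : ∀ i, σ i = 1 ∨ σ i = -1)
    (A : Finset (Fin n)) : ∑ i ∈ A, σ i * p i ≤ orthantFun f σ A := by
  rw [← signedSum_signPart hσ]
  exact hp _ _ (disjoint_signPart σ A)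

lemma signedGreedy_mem_extremePoints (hf : Bisubmodular n f) (hf0 : f ∅ ∅ = 0)
    (δ : Equiv.Perm (Fin n)) (hσ : ∀ i, σ i = 1 ∨ σ i = -1) :
    signedGreedy n f δ σ ∈ (bisubPolyhedron n f).extremePoints ℝ := by
  refine ⟨signedGreedy_mem_bisubPolyhedron hf hf0 δ hσ, ?_⟩
  rintro x hx y hy ⟨a, b, ha, hb, hab, hxy⟩
  rw [eq_signedGreedy_iff hf0 δ hσ]
  intro k
  have h1 := sum_le_orthantFun hx hσ (permPrefix δ k)
  have h2 := sum_le_orthantFun hy hσ (permPrefix δ k)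
  have h3 := (eq_signedGreedy_iff hf0 δ hσ).1 hxy k
  have h4 : ∑ i ∈ permPrefix δ k, σ i * (a • x + b • y) i =
      a * ∑ i ∈ permPrefix δ k, σ i * x i + b * ∑ i ∈ permPrefix δ k, σ i * y i := by
    rw [Finset.mul_sum, Finset.mul_sum, ← Finset.sum_add_distrib]
    refine Finset.sum_congr rfl fun i _ => ?_
    simp only [Pi.add_apply, Pi.smul_apply, smul_eq_mul]
    ring
  rw [h4] at h3
  obtain rfl : b = 1 - a := by linarith
  refine h1.antisymm (le_of_mul_le_mul_left ?_ ha)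
  nlinarith [mul_le_mul_of_nonneg_left h2 hb.le]

end Greedy

lemma exists_perm_forall_permPrefix {n : ℕ} {𝒯 : Finset (Fin n) → Prop} (hempty : 𝒯 ∅)
    (huniv : 𝒯 univ) (hinter : ∀ A B, 𝒯 A → 𝒯 B → 𝒯 (A ∩ B))
    (hunion : ∀ A B, 𝒯 A → 𝒯 B → 𝒯 (A ∪ B))
    (hsep : ∀ u v, (∀ A, 𝒯 A → (u ∈ A ↔ v ∈ A)) → u = v) :
    ∃ δ : Equiv.Perm (Fin n), ∀ k, 𝒯 (permPrefix δ k) := by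
  classical
  let D : Fin n → Finset (Fin n) := fun u => (univ.filter fun A => 𝒯 A ∧ u ∈ A).inf id
  have hmemD : ∀ u w, w ∈ D u ↔ ∀ A, 𝒯 A → u ∈ A → w ∈ A := by
    intro u w
    simp only [D, Finset.mem_inf, Finset.mem_filter, Finset.mem_univ, true_and, id, and_imp]
  have hD : ∀ u, 𝒯 (D u) := fun u =>
    Finset.inf_induction huniv (fun A hA B hB => hinter A B hA hB) fun A hA =>
      (Finset.mem_filter.1 hA).2.1
  have hself : ∀ u, u ∈ D u := fun u => (hmemD u u).2 fun _ _ h => h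
  have hlt : ∀ u w, w ∈ D u → w ≠ u → (D w).card < (D u).card := by
    intro u w hw hne
    refine Finset.card_lt_card (Finset.ssubset_iff_subset_ne.2 ⟨?_, ?_⟩)
    · intro z hz
      exact (hmemD w z).1 hz _ (hD u) hw
    · intro h
      refine hne (hsep w u fun A hA => ⟨fun hwA => ?_, fun huA => (hmemD u w).1 hw A hA huA⟩)
      exact (hmemD w u).1 (h ▸ hself u) A hA hwA
  let δ := Tuple.sort fun u => (D u).card
  have hmono : Monotone ((fun u => (D u).card) ∘ δ) := Tuple.monotone_sort _
  refine ⟨δ, fun k => ?_⟩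
  have : permPrefix δ k = (permPrefix δ k).sup D := by
    ext w
    rw [Finset.mem_sup]
    refine ⟨fun hw => ⟨w, hw, hself w⟩, ?_⟩
    rintro ⟨u, hu, hw⟩
    by_cases hne : w = u
    · rwa [hne]
    simp only [permPrefix, Finset.mem_filter, Finset.mem_univ, true_and] at hu ⊢
    refine lt_of_le_of_lt (not_lt.1 fun hlt' => ?_) hu
    have h := hmono (Fin.le_def.2 hlt'.le)
    simp only [Function.comp_apply, Equiv.apply_symm_apply] at h
    exact absurd (hlt u w hw hne) (not_lt.2 h)
  rw [this]
  exact Finset.sup_induction hempty (fun A hA B hB => hunion A B hA hB) fun u _ => hD u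

section ExtremePoints

variable {n : ℕ} {f : Finset (Fin n) → Finset (Fin n) → ℝ} {p : Fin n → ℝ}

lemma signedSum_add_smul (p d : Fin n → ℝ) (ε : ℝ) (S₁ S₂ : Finset (Fin n)) :
    signedSum (p + ε • d) S₁ S₂ = signedSum p S₁ S₂ + ε * signedSum d S₁ S₂ := by
  simp only [signedSum, Pi.add_apply, Pi.smul_apply, smul_eq_mul, Finset.sum_add_distrib,
    ← Finset.mul_sum]
  ring

lemma eq_zero_of_signedSum_isTight_eq_zero (hp : p ∈ (bisubPolyhedron n f).extremePoints ℝ)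
    {d : Fin n → ℝ} (hd : ∀ S₁ S₂, IsTight f p S₁ S₂ → signedSum d S₁ S₂ = 0) : d = 0 := by
  have hev : ∀ᶠ ε in nhds (0 : ℝ), p + ε • d ∈ bisubPolyhedron n f := by
    simp only [bisubPolyhedron, Set.mem_ofPred_eq, Filter.eventually_all]
    intro S₁ S₂ hS
    change ∀ᶠ ε in nhds (0 : ℝ), signedSum (p + ε • d) S₁ S₂ ≤ _
    simp only [signedSum_add_smul]
    have hle : signedSum p S₁ S₂ ≤ f S₁ S₂ := hp.1 S₁ S₂ hS
    rcases hle.eq_or_lt with h | h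
    · simp [hd S₁ S₂ ⟨hS, h⟩, hle]
    · have hc : ContinuousAt
          (fun ε : ℝ => signedSum p S₁ S₂ + ε * signedSum d S₁ S₂) 0 := by fun_prop
      exact (hc.eventually_lt continuousAt_const (by simpa using h)).mono fun _ => le_of_lt
  obtain ⟨r, hr, h⟩ := Metric.eventually_nhds_iff.1 hev
  have h1 : p + (r / 2) • d ∈ bisubPolyhedron n f := h (by
    rw [dist_zero_right, Real.norm_eq_abs, abs_of_pos (by positivity)]; linarith)
  have h2 : p + (-(r / 2)) • d ∈ bisubPolyhedron n f := h (by
    rw [dist_zero_right, norm_neg, Real.norm_eq_abs, abs_of_pos (by positivity)]; linarith)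
  have h3 : p + (r / 2) • d = p := hp.2 h1 h2
    ⟨1 / 2, 1 / 2, by norm_num, by norm_num, by norm_num, by module⟩
  rw [add_eq_left, smul_eq_zero] at h3
  exact h3.resolve_left (by positivity)

lemma exists_isTight_union_eq_univ (hf : Bisubmodular n f) (hf0 : f ∅ ∅ = 0)
    (hp : p ∈ (bisubPolyhedron n f).extremePoints ℝ) :
    ∃ B₁ B₂, IsTight f p B₁ B₂ ∧ B₁ ∪ B₂ = univ := by
  classical
  obtain ⟨⟨B₁, B₂⟩, hB, hmax⟩ := Finset.exists_max_image
    (univ.filter fun S : Finset (Fin n) × Finset (Fin n) => IsTight f p S.1 S.2)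
    (fun S => (S.1 ∪ S.2).card)
    ⟨(∅, ∅), Finset.mem_filter.2
      ⟨Finset.mem_univ _, by simp [IsTight, signedSum, hf0]⟩⟩
  simp only [Finset.mem_filter, Finset.mem_univ, true_and] at hB hmax
  refine ⟨B₁, B₂, hB, Finset.eq_univ_iff_forall.2 fun i => ?_⟩
  by_contra hi
  have h0 : (Pi.single i 1 : Fin n → ℝ) = 0 := by
    refine eq_zero_of_signedSum_isTight_eq_zero hp fun T₁ T₂ hT => ?_
    have hiT : i ∉ T₁ ∪ T₂ := by
      intro hiT
      have hC := (hB.inter_union hf hp.1 hT).2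
      have hE := (hC.inter_union hf hp.1 hB).2
      refine absurd (hmax (_, _) hE) (not_le.2 (Finset.card_lt_card ?_))
      refine (Finset.ssubset_iff_of_subset ?_).2 ⟨i, ?_, hi⟩
      · intro j hj
        have hjB : j ∈ B₁ → j ∉ B₂ := fun h => Finset.disjoint_left.1 hB.1 h
        have hjT : j ∈ T₁ → j ∉ T₂ := fun h => Finset.disjoint_left.1 hT.1 h
        simp only [Finset.mem_union, Finset.mem_sdiff] at hj ⊢
        tauto
      · have hiT' : i ∈ T₁ → i ∉ T₂ := fun h => Finset.disjoint_left.1 hT.1 h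
        simp only [Finset.mem_union, Finset.mem_sdiff] at hi hiT ⊢
        tauto
    rw [Finset.mem_union, not_or] at hiT
    simp [signedSum, hiT]
  simpa using congrFun h0 i

lemma exists_eq_signedGreedy (hf : Bisubmodular n f) (hf0 : f ∅ ∅ = 0)
    (hp : p ∈ (bisubPolyhedron n f).extremePoints ℝ) :
    ∃ (δ : Equiv.Perm (Fin n)) (σ : Fin n → ℝ),
      (∀ i, σ i = 1 ∨ σ i = -1) ∧ p = signedGreedy n f δ σ := by
  classical
  obtain ⟨B₁, B₂, hB, hcover⟩ := exists_isTight_union_eq_univ hf hf0 hp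
  let σ : Fin n → ℝ := fun i => if i ∈ B₁ then 1 else -1
  have hσ : ∀ i, σ i = 1 ∨ σ i = -1 := fun i => by simp only [σ]; split_ifs <;> simp
  have hB₁ : signPart σ 1 univ = B₁ := by
    ext i
    by_cases h : i ∈ B₁ <;> norm_num [signPart, σ, h]
  have hB₂ : signPart σ (-1) univ = B₂ := by
    ext i
    have h1 : i ∈ B₁ → i ∉ B₂ := fun h => Finset.disjoint_left.1 hB.1 h
    have h2 := Finset.eq_univ_iff_forall.1 hcover i
    rw [Finset.mem_union] at h2
    by_cases h : i ∈ B₁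
    · norm_num [signPart, σ, h, h1 h]
    · norm_num [signPart, σ, h, h2.resolve_left h]
  have htight : ∀ A, IsTight f p (signPart σ 1 A) (signPart σ (-1) A) ↔
      ∑ i ∈ A, σ i * p i = orthantFun f σ A := fun A => by
    rw [IsTight, signedSum_signPart hσ, orthantFun, and_iff_right (disjoint_signPart σ A)]
  have hBt : IsTight f p (signPart σ 1 univ) (signPart σ (-1) univ) := by rwa [hB₁, hB₂]
  obtain ⟨δ, hδ⟩ := exists_perm_forall_permPrefix
    (𝒯 := fun A => IsTight f p (signPart σ 1 A) (signPart σ (-1) A))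
    ((htight ∅).2 (by simp [orthantFun_empty hf0])) hBt
    (fun A B hA hB => by
      simpa only [signPart_inter] using (hA.inter_union hf hp.1 hB).1)
    (fun A B hA hB => by
      have h := (hA.inter_union hf hp.1 hB).2
      rwa [signPart_union_sdiff σ (by norm_num), signPart_union_sdiff σ (by norm_num)] at h)
    (fun u v huv => by
      by_contra hne
      have hd : ∀ A : Finset (Fin n),
          ∑ i ∈ A, σ i * (Pi.single u (σ u) - Pi.single v (σ v) : Fin n → ℝ) i =
            (if u ∈ A then 1 else 0) - (if v ∈ A then 1 else 0) := by
        intro A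
        have hsq : ∀ i, σ i * σ i = 1 := fun i => by rcases hσ i with h | h <;> simp [h]
        simp [mul_sub, Finset.sum_sub_distrib, Pi.single_apply, hsq]
      have h0 : (Pi.single u (σ u) - Pi.single v (σ v) : Fin n → ℝ) = 0 := by
        refine eq_zero_of_signedSum_isTight_eq_zero hp fun T₁ T₂ hT => ?_
        obtain ⟨A, A', h1, h2, h3, h4⟩ := exists_inter_union_eq_signPart hσ hT.1
        have ht := hT.inter_union hf hp.1 hBt
        have hs := signedSum_inter_add_signedSum_union
          (Pi.single u (σ u) - Pi.single v (σ v)) hT.1 hBt.1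
        rw [h1, h2, h3, h4] at ht hs
        simp only [signedSum_signPart hσ, hd, huv A ht.1, huv A' ht.2, Finset.mem_univ,
          if_true, sub_self, add_zero] at hs
        exact hs.symm
      have hu := congrFun h0 u
      rcases hσ u with h | h <;> simp [hne, h] at hu)
  exact ⟨δ, σ, hσ, (eq_signedGreedy_iff hf0 δ hσ).2 fun k => (htight _).1 (hδ k)⟩

end ExtremePoints

/-- the extreme points of `P_f` are exactly the signed greedy
vectors. -/
theorem stmt8 (n : ℕ) (hn : 0 < n) (f : Finset (Fin n) → Finset (Fin n) → ℝ)
    (hf : Bisubmodular n f) (hf0 : f ∅ ∅ = 0) (π : Fin n → ℝ) :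
    π ∈ (bisubPolyhedron n f).extremePoints ℝ ↔
      ∃ (δ : Equiv.Perm (Fin n)) (σ : Fin n → ℝ),
        (∀ i, σ i = 1 ∨ σ i = -1) ∧ π = signedGreedy n f δ σ := by
  constructor
  · exact exists_eq_signedGreedy hf hf0
  · rintro ⟨δ, σ, hσ, rfl⟩
    exact signedGreedy_mem_extremePoints hf hf0 δ hσ
end

section
/- Let f : 3^N → ℝ be a bisubmodular function with f(∅,∅) = 0 and let x̄ ∈ ℝ^n. Let δ be a permutation of N such that |x̄_{δ₁}| ≥ |x̄_{δ₂}| ≥ … ≥ |x̄_{δ_n}|, and define σ ∈ {−1,1}^n by σ_i = 1 if x̄_i ≥ 0 and σ_i = −1 otherwise. Then the signed greedy vector π^{δ,σ} maximizes the linear function π ↦ π·x̄ over the bisubmodular polyhedron P_f; that is, π^{δ,σ} ∈ P_f and π^{δ,σ}·x̄ ≥ ρ·x̄ for every ρ ∈ P_f. -/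
open Finset

/-- The set of the first `k` elements in the order given by `δ`. -/
def permInitial {n : ℕ} (δ : Equiv.Perm (Fin n)) (k : ℕ) : Finset (Fin n) :=
  univ.filter fun i => (δ.symm i : ℕ) < k

theorem mem_permInitial {n : ℕ} {δ : Equiv.Perm (Fin n)} {k : ℕ} {i : Fin n} :
    i ∈ permInitial δ k ↔ (δ.symm i : ℕ) < k := by
  simp [permInitial]

theorem permInitial_zero {n : ℕ} (δ : Equiv.Perm (Fin n)) : permInitial δ 0 = ∅ := by
  ext i
  simp [mem_permInitial]

theorem permInitial_self {n : ℕ} (δ : Equiv.Perm (Fin n)) : permInitial δ n = univ := by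
  ext i
  simp [mem_permInitial]

theorem notMem_permInitial {n : ℕ} (δ : Equiv.Perm (Fin n)) (k : Fin n) :
    δ k ∉ permInitial δ k := by
  simp [mem_permInitial]

theorem permInitial_succ {n : ℕ} (δ : Equiv.Perm (Fin n)) (k : Fin n) :
    permInitial δ (k + 1) = insert (δ k) (permInitial δ k) := by
  ext i
  rw [mem_insert, mem_permInitial, mem_permInitial, ← Equiv.symm_apply_eq, Fin.ext_iff]
  omega

theorem permInitial_succ_of_le {n : ℕ} (δ : Equiv.Perm (Fin n)) {k : ℕ} (hk : n ≤ k) :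
    permInitial δ (k + 1) = permInitial δ k := by
  ext i
  rw [mem_permInitial, mem_permInitial]
  omega

/-- The set function obtained from `f` by giving each element the sign prescribed by `σ`. -/
noncomputable def orthantRestrict {n : ℕ} (f : Finset (Fin n) → Finset (Fin n) → ℝ)
    (σ : Fin n → ℝ) (T : Finset (Fin n)) : ℝ :=
  f (T.filter fun i => σ i = 1) (T.filter fun i => σ i = -1)

theorem disjoint_filter_signs {n : ℕ} (σ : Fin n → ℝ) (S T : Finset (Fin n)) :
    Disjoint (S.filter fun i => σ i = 1) (T.filter fun i => σ i = -1) := by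
  rw [disjoint_left]
  intro i hi hi'
  have h₁ := (mem_filter.1 hi).2
  have h₂ := (mem_filter.1 hi').2
  linarith

theorem Bisubmodular.orthantRestrict_submodular {n : ℕ}
    {f : Finset (Fin n) → Finset (Fin n) → ℝ} (hf : Bisubmodular n f) (σ : Fin n → ℝ)
    (S T : Finset (Fin n)) :
    orthantRestrict f σ (S ∩ T) + orthantRestrict f σ (S ∪ T) ≤
      orthantRestrict f σ S + orthantRestrict f σ T := by
  have h := hf _ _ _ _ (disjoint_filter_signs σ S S) (disjoint_filter_signs σ T T)
  rw [← filter_union, ← filter_union, sdiff_eq_self_of_disjoint (disjoint_filter_signs σ _ _),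
    sdiff_eq_self_of_disjoint (disjoint_filter_signs σ _ _).symm,
    ← filter_inter_distrib, ← filter_inter_distrib] at h
  exact h

/-- The increments of a submodular function along the chain of initial segments of `δ`. -/
def chainIncrement {n : ℕ} (g : Finset (Fin n) → ℝ) (δ : Equiv.Perm (Fin n)) (i : Fin n) : ℝ :=
  g (permInitial δ ((δ.symm i : ℕ) + 1)) - g (permInitial δ (δ.symm i))

theorem sum_chainIncrement_permInitial {n : ℕ} {g : Finset (Fin n) → ℝ} (hg : g ∅ = 0)
    (δ : Equiv.Perm (Fin n)) (k : ℕ) :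
    ∑ i ∈ permInitial δ k, chainIncrement g δ i = g (permInitial δ k) := by
  induction k with
  | zero => simp [permInitial_zero, hg]
  | succ k ih =>
    rcases le_or_gt n k with hk | hk
    · rw [permInitial_succ_of_le δ hk, ih]
    · have h := permInitial_succ δ ⟨k, hk⟩
      have h' := notMem_permInitial δ ⟨k, hk⟩
      simp only at h h'
      rw [h, sum_insert h', ih, ← h]
      simp [chainIncrement]

/-- Feasibility of the greedy vector of a submodular function. -/
theorem sum_chainIncrement_le {n : ℕ} {g : Finset (Fin n) → ℝ} (hg : g ∅ = 0)
    (hsub : ∀ S T, g (S ∩ T) + g (S ∪ T) ≤ g S + g T)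
    (δ : Equiv.Perm (Fin n)) (T : Finset (Fin n)) :
    ∑ i ∈ T, chainIncrement g δ i ≤ g T := by
  suffices H : ∀ k T, T ⊆ permInitial δ k → ∑ i ∈ T, chainIncrement g δ i ≤ g T from
    H n T (by simp [permInitial_self])
  intro k
  induction k with
  | zero =>
    intro T hT
    rw [permInitial_zero, subset_empty] at hT
    simp [hT, hg]
  | succ k ih =>
    intro T hT
    rcases le_or_gt n k with hk | hk
    · exact ih T (permInitial_succ_of_le δ hk ▸ hT)
    · have h := permInitial_succ δ ⟨k, hk⟩
      have h' := notMem_permInitial δ ⟨k, hk⟩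
      simp only at h h'
      by_cases he : δ ⟨k, hk⟩ ∈ T
      · have hinter : T ∩ permInitial δ k = T.erase (δ ⟨k, hk⟩) := by
          ext i
          have := @hT i
          grind
        have hunion : T ∪ permInitial δ k = permInitial δ (k + 1) := by
          ext i
          have := @hT i
          grind
        have h₁ := hsub T (permInitial δ k)
        rw [hinter, hunion] at h₁
        have h₂ := ih (T.erase (δ ⟨k, hk⟩)) (hinter ▸ inter_subset_right)
        rw [← add_sum_erase T _ he]
        have h₃ : chainIncrement g δ (δ ⟨k, hk⟩) =
            g (permInitial δ (k + 1)) - g (permInitial δ k) := by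
          simp [chainIncrement]
        linarith
      · exact ih T ((subset_insert_iff_of_notMem he).1 (h ▸ hT))

/-- Abel summation: nonnegative partial sums against nonincreasing weights. -/
theorem sum_mul_nonneg_of_permInitial {n : ℕ} (δ : Equiv.Perm (Fin n)) {a d : Fin n → ℝ}
    (ha : ∀ i, 0 ≤ a i) (hanti : ∀ j k : Fin n, j ≤ k → a (δ k) ≤ a (δ j))
    (hd : ∀ k, 0 ≤ ∑ i ∈ permInitial δ k, d i) :
    0 ≤ ∑ i, a i * d i := by
  suffices H : ∀ k c, (∀ i ∈ permInitial δ k, c ≤ a i) →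
      c * ∑ i ∈ permInitial δ k, d i ≤ ∑ i ∈ permInitial δ k, a i * d i by
    simpa [permInitial_self] using H n 0 fun i _ => ha i
  intro k
  induction k with
  | zero => simp [permInitial_zero]
  | succ k ih =>
    intro c hc
    rcases le_or_gt n k with hk | hk
    · rw [permInitial_succ_of_le δ hk] at hc ⊢
      exact ih c hc
    · have h := permInitial_succ δ ⟨k, hk⟩
      have h' := notMem_permInitial δ ⟨k, hk⟩
      simp only at h h'
      refine (mul_le_mul_of_nonneg_right (hc (δ ⟨k, hk⟩) (by simp [h])) (hd (k + 1))).trans ?_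
      rw [h, sum_insert h', sum_insert h', mul_add]
      gcongr
      refine ih _ fun i hi => ?_
      have hi' := hanti (δ.symm i) ⟨k, hk⟩ (Fin.le_def.2 (mem_permInitial.1 hi).le)
      simpa using hi'

theorem signedGreedy_eq {n : ℕ} (f : Finset (Fin n) → Finset (Fin n) → ℝ)
    (δ : Equiv.Perm (Fin n)) (σ : Fin n → ℝ) (i : Fin n) :
    signedGreedy n f δ σ i = σ i * chainIncrement (orthantRestrict f σ) δ i := by
  have h₁ : ∀ k, greedyS1 n δ σ k = (permInitial δ k).filter fun i => σ i = 1 := by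
    intro k
    ext i
    simp only [greedyS1, mem_image, mem_filter, mem_univ, true_and, mem_permInitial]
    exact ⟨by rintro ⟨j, hj, rfl⟩; simpa using hj, fun hi => ⟨δ.symm i, by simpa using hi⟩⟩
  have h₂ : ∀ k, greedyS2 n δ σ k = (permInitial δ k).filter fun i => σ i = -1 := by
    intro k
    ext i
    simp only [greedyS2, mem_image, mem_filter, mem_univ, true_and, mem_permInitial]
    exact ⟨by rintro ⟨j, hj, rfl⟩; simpa using hj, fun hi => ⟨δ.symm i, by simpa using hi⟩⟩
  simp only [signedGreedy, chainIncrement, orthantRestrict, h₁, h₂]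

theorem sum_filter_sub_sum_filter {n : ℕ} {σ : Fin n → ℝ} (hσ : ∀ i, σ i = 1 ∨ σ i = -1)
    (p : Fin n → ℝ) (T : Finset (Fin n)) :
    ∑ i ∈ T.filter (fun i => σ i = 1), p i - ∑ i ∈ T.filter (fun i => σ i = -1), p i =
      ∑ i ∈ T, σ i * p i := by
  rw [sum_filter, sum_filter, ← sum_sub_distrib]
  refine sum_congr rfl fun i _ => ?_
  rcases hσ i with h | h <;> rw [h] <;> norm_num

/-- A vector satisfying the constraints of the orthant of `σ`, with equality for the full sign
vector, lies in the bisubmodular polyhedron. -/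
theorem Bisubmodular.mem_bisubPolyhedron {n : ℕ} {f : Finset (Fin n) → Finset (Fin n) → ℝ}
    (hf : Bisubmodular n f) {σ : Fin n → ℝ} (hσ : ∀ i, σ i = 1 ∨ σ i = -1) {p : Fin n → ℝ}
    (hle : ∀ T, ∑ i ∈ T, σ i * p i ≤ orthantRestrict f σ T)
    (huniv : ∑ i, σ i * p i = orthantRestrict f σ univ) :
    p ∈ bisubPolyhedron n f := by
  intro S₁ S₂ hS
  set P := univ.filter fun i => σ i = 1 with hP
  set M := univ.filter fun i => σ i = -1 with hM
  have hPM : ∀ i, i ∈ M ↔ i ∉ P := by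
    intro i
    rcases hσ i with h | h <;> norm_num [hP, hM, h]
  have key : ∀ A B : Finset (Fin n), A ⊆ P → B ⊆ M →
      ∑ i ∈ A, p i - ∑ i ∈ B, p i ≤ f A B := by
    intro A B hA hB
    have h := hle (A ∪ B)
    have hA' : (A ∪ B).filter (fun i => σ i = 1) = A := by
      ext i
      have := @hA i
      have := @hB i
      have := hPM i
      have : i ∈ P ↔ σ i = 1 := by simp [hP]
      grind
    have hB' : (A ∪ B).filter (fun i => σ i = -1) = B := by
      ext i
      have := @hA i
      have := @hB i
      have := hPM i
      have : i ∈ M ↔ σ i = -1 := by simp [hM]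
      grind
    rwa [← sum_filter_sub_sum_filter hσ, orthantRestrict, hA', hB'] at h
  rw [← sum_filter_sub_sum_filter hσ, orthantRestrict, ← hP, ← hM] at huniv
  have hdisj : ∀ i, i ∈ S₁ → i ∉ S₂ := fun i h => disjoint_left.1 hS h
  have hbi := hf S₁ S₂ P M hS (disjoint_filter_signs σ _ _)
  have h₁ := key (S₁ ∩ P) (S₂ ∩ M) inter_subset_right inter_subset_right
  have h₂ := key ((S₁ ∪ P) \ (S₂ ∪ M)) ((S₂ ∪ M) \ (S₁ ∪ P))
    (fun i hi => by have := hPM i; grind) (fun i hi => by have := hPM i; grind)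
  have hsum : (∑ i ∈ S₁ ∩ P, p i - ∑ i ∈ S₂ ∩ M, p i) +
      (∑ i ∈ (S₁ ∪ P) \ (S₂ ∪ M), p i - ∑ i ∈ (S₂ ∪ M) \ (S₁ ∪ P), p i) =
      (∑ i ∈ S₁, p i - ∑ i ∈ S₂, p i) + (∑ i ∈ P, p i - ∑ i ∈ M, p i) := by
    have hind : ∀ A : Finset (Fin n), ∑ i ∈ A, p i = ∑ i, if i ∈ A then p i else 0 := by simp
    simp only [hind, ← sum_sub_distrib, ← sum_add_distrib]
    refine sum_congr rfl fun i _ => ?_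
    simp only [mem_inter, mem_sdiff, mem_union, hPM]
    by_cases a : i ∈ S₁
    · have b := hdisj i a
      by_cases c : i ∈ P <;> simp [a, b, c]
    · by_cases b : i ∈ S₂ <;> by_cases c : i ∈ P <;> simp [a, b, c]
  linarith

/-- the generalized greedy algorithm maximizes `π ↦ π·x̄` over
`P_f`. -/
theorem stmt9 (n : ℕ) (hn : 0 < n) (f : Finset (Fin n) → Finset (Fin n) → ℝ)
    (hf : Bisubmodular n f) (hf0 : f ∅ ∅ = 0)
    (xb : Fin n → ℝ) (δ : Equiv.Perm (Fin n))
    (hsort : ∀ j k : Fin n, j ≤ k → |xb (δ k)| ≤ |xb (δ j)|)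
    (σ : Fin n → ℝ) (hσ : ∀ i, σ i = if 0 ≤ xb i then 1 else -1) :
    signedGreedy n f δ σ ∈ bisubPolyhedron n f ∧
    ∀ ρ ∈ bisubPolyhedron n f,
      ∑ i, ρ i * xb i ≤ ∑ i, signedGreedy n f δ σ i * xb i := by
  have hs : ∀ i, σ i = 1 ∨ σ i = -1 := by
    intro i
    rw [hσ i]
    split_ifs <;> simp
  have hsq : ∀ i, σ i * σ i = 1 := by
    intro i
    rcases hs i with h | h <;> rw [h] <;> norm_num
  have hx : ∀ i, xb i = |xb i| * σ i := by
    intro i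
    rw [hσ i]
    split_ifs with h
    · rw [abs_of_nonneg h, mul_one]
    · rw [abs_of_neg (not_le.1 h)]
      ring
  have hg : orthantRestrict f σ ∅ = 0 := by simpa [orthantRestrict] using hf0
  have hπ : ∀ i, σ i * signedGreedy n f δ σ i = chainIncrement (orthantRestrict f σ) δ i := by
    intro i
    rw [signedGreedy_eq, ← mul_assoc, hsq, one_mul]
  refine ⟨hf.mem_bisubPolyhedron hs (fun T => ?_) ?_, fun ρ hρ => ?_⟩
  · simp only [hπ]
    exact sum_chainIncrement_le hg (hf.orthantRestrict_submodular σ) δ T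
  · simp only [hπ]
    simpa only [permInitial_self] using sum_chainIncrement_permInitial hg δ n
  · have habel := sum_mul_nonneg_of_permInitial δ (a := fun i => |xb i|)
      (d := fun i => σ i * signedGreedy n f δ σ i - σ i * ρ i) (fun i => abs_nonneg _) hsort
      (fun k => by
        have h := hρ _ _ (disjoint_filter_signs σ (permInitial δ k) (permInitial δ k))
        rw [sum_filter_sub_sum_filter hs] at h
        simp only [hπ]
        rw [sum_sub_distrib, sum_chainIncrement_permInitial hg, sub_nonneg]
        exact h)
    rw [← sub_nonneg, ← sum_sub_distrib]
    refine habel.trans_eq (sum_congr rfl fun i _ => ?_)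
    conv_rhs => rw [hx i]
    ring
end
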